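/- arXiv:2604.20892 — 6 statements merged into one kernel-verified Lean document; each statement's English description precedes it below -/
import Mathlib

section
/- Let P and Q be distinct monic irreducible polynomials in A = F_q[t]. Suppose α, β ∈ F_q satisfy the congruences Q^((|P|−1)/d) ≡ α (mod P) and P^((|Q|−1)/d) ≡ β (mod Q) (where elements of F_q are viewed as constant polynomials). Then β · α⁻¹ = (−1)^(((q−1)/d) · deg P · deg Q) in F_q. (Equivalently, the d-th power residue symbols satisfy (P/Q)_d · (Q/P)_d^(−1) = (−1)^(((q−1)/d)·deg P·deg Q).) -/
open Polynomial

theorem key {F : Type*} [Field F] [Fintype F] (P Q : F[X]) (hPm : P.Monic) (hPi : Irreducible P)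
   (d : ℕ) (hd : 0 < d) (hdvd : d ∣ Fintype.card F - 1) (α : F)
   (hα : P ∣ Q ^ ((Fintype.card F ^ P.natDegree - 1) / d) - C α) :
   resultant P Q ^ ((Fintype.card F - 1) / d) = α := by
  have : Fact (Irreducible P) := ⟨hPi⟩
  have hP0 := hPm.ne_zero
  let pb := AdjoinRoot.powerBasis hP0
  have : FiniteDimensional F (AdjoinRoot P) := pb.finite
  have : Finite (AdjoinRoot P) := Module.finite_of_finite F
  have hgen : pb.gen = AdjoinRoot.root P := AdjoinRoot.powerBasis_gen hP0
  have hmin : minpoly F pb.gen = P := by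
    rw [hgen, AdjoinRoot.minpoly_root hP0, hPm.leadingCoeff]; simp
  have hfr : Module.finrank F (AdjoinRoot P) = P.natDegree := by
    rw [pb.finrank]; exact AdjoinRoot.powerBasis_dim hP0
  have hcK : Nat.card (AdjoinRoot P) = Fintype.card F ^ P.natDegree := by
    rw [Module.natCard_eq_pow_finrank (K := F), hfr, Nat.card_eq_fintype_card]
  have hsep : P.Separable := PerfectField.separable_of_irreducible hPi
  have hnorm : Algebra.norm F (AdjoinRoot.mk P Q) = resultant P Q := by
    let E := AlgebraicClosure F
    apply (algebraMap F E).injective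
    rw [Algebra.norm_eq_prod_embeddings, ← resultant_map_map,
      ← natDegree_map (f := algebraMap F E) (p := P), resultant_eq_prod_eval _ _ _ natDegree_map_le
       (IsAlgClosed.splits _), (hPm.map _).leadingCoeff, one_pow, one_mul]
    classical
    letI : Fintype {y : E // y ∈ (minpoly F pb.gen).aroots E} :=
      Fintype.subtype ((minpoly F pb.gen).aroots E).toFinset (fun _ => Multiset.mem_toFinset)
    have h1 : (∏ σ : AdjoinRoot P →ₐ[F] E, σ (AdjoinRoot.mk P Q)) = ∏ y : {y : E // y ∈ (minpoly F pb.gen).aroots E}, aeval (y : E) Q := by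
      refine Fintype.prod_equiv pb.liftEquiv' _ _ ?_
      intro σ
      rw [PowerBasis.liftEquiv'_apply_coe, hgen, aeval_algHom_apply, AdjoinRoot.aeval_eq]
    rw [h1]
    rw [← Finset.prod_subtype ((minpoly F pb.gen).aroots E).toFinset
      (fun _ => Multiset.mem_toFinset) (fun y => aeval y Q), hmin, Finset.prod,
      Multiset.toFinset_val, Multiset.dedup_eq_self.2 (nodup_roots hsep.map)]
    simp [aeval_def, eval_map, aroots]
  apply (AdjoinRoot.of P).injective
  rw [← hnorm, map_pow]
  have := FiniteField.algebraMap_norm_eq_pow (K := F) (K' := AdjoinRoot P) (x := AdjoinRoot.mk P Q)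
  rw [AdjoinRoot.algebraMap_eq] at this
  rw [this, hcK, Nat.card_eq_fintype_card, ← pow_mul]
  have hA : (AdjoinRoot.mk P (Q ^ ((Fintype.card F ^ P.natDegree - 1) / d) - C α)) = 0 := AdjoinRoot.mk_eq_zero.2 hα
  rw [map_sub, map_pow, sub_eq_zero, AdjoinRoot.mk_C] at hA
  rw [← hA]
  congr 1
  have hq1 : 0 < Fintype.card F - 1 := Nat.sub_pos_of_lt Fintype.one_lt_card
  obtain ⟨k, hk⟩ : Fintype.card F - 1 ∣ Fintype.card F ^ P.natDegree - 1 := by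
    simpa using Nat.sub_dvd_pow_sub_pow (Fintype.card F) 1 P.natDegree
  obtain ⟨e, he⟩ := hdvd
  rw [hk, Nat.mul_div_cancel_left _ hq1, he, Nat.mul_div_cancel_left _ hd, mul_assoc,
    Nat.mul_div_cancel_left _ hd, mul_comm]

theorem stmt0 {p n q d : ℕ} (hp : p.Prime) (hpodd : Odd p) (hn : 0 < n)
    (hq : q = p ^ n) (F : Type*) [Field F] [Fintype F]
    (hcard : Fintype.card F = q) (hd : 0 < d) (hdvd : d ∣ q - 1)
    (P Q : Polynomial F) (hPm : P.Monic) (hQm : Q.Monic)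
    (hPi : Irreducible P) (hQi : Irreducible Q) (hPQ : P ≠ Q)
    (α β : F)
    (hα : P ∣ Q ^ ((q ^ P.natDegree - 1) / d) - C α)
    (hβ : Q ∣ P ^ ((q ^ Q.natDegree - 1) / d) - C β) :
    β * α⁻¹ = (-1 : F) ^ (((q - 1) / d) * P.natDegree * Q.natDegree) := by
  subst hcard
  have hα0 : α ≠ 0 := by
    rintro rfl
    rw [C_0, sub_zero] at hα
    have h := hPi.prime.dvd_of_dvd_pow hα
    exact hPQ (eq_of_monic_of_associated hPm hQm (hPi.associated_of_dvd hQi h))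
  have h1 := key P Q hPm hPi d hd hdvd α hα
  have h2 := key Q P hQm hQi d hd hdvd β hβ
  rw [← div_eq_mul_inv, div_eq_iff hα0, ← h1, ← h2, resultant_comm Q P, mul_pow, ← pow_mul]
  congr 2
  ring
end

section
/- Let P and Q be distinct monic irreducible polynomials in A = F_q[t], let η ∈ F_q^* have order d, and let G = (A/(Q))^*. If S ⊆ G is a complete set of coset representatives for the subgroup generated by (the image of) η in G, then (∏_{s ∈ S} s)^(|P|−1) = (−1)^(((|P|−1)/d)·((|Q|−1)/d)) · (∏_{x ∈ G} x)^((|P|−1)/d) in G. -/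
open Polynomial

lemma aux_complement {G : Type*} [CommGroup G] [Fintype G] (u : G) (S : Finset G)
    (hS : Subgroup.IsComplement (S : Set G) (Subgroup.zpowers u : Set G)) :
    Fintype.card G = S.card * orderOf u ∧
    ∏ x : G, x = (∏ s ∈ S, s) ^ orderOf u * (u ^ (∑ i ∈ Finset.range (orderOf u), i)) ^ S.card := by
  classical
  have hb : Function.Bijective (fun x : S × Fin (orderOf u) => (x.1 : G) * u ^ (x.2 : ℕ)) := by
    have h1 : Function.Bijective (fun x : S × Fin (orderOf u) =>
        ((⟨x.1.1, x.1.2⟩ : (S : Set G)), (finEquivZPowers (isOfFinOrder_of_finite u)) x.2)) := by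
      constructor
      · rintro ⟨a, b⟩ ⟨a', b'⟩ h
        simp only [Prod.mk.injEq, EmbeddingLike.apply_eq_iff_eq, Subtype.mk.injEq] at h
        exact Prod.ext (Subtype.ext h.1) h.2
      · rintro ⟨a, b⟩
        obtain ⟨k, hk⟩ := (finEquivZPowers (isOfFinOrder_of_finite u)).surjective b
        exact ⟨(⟨a.1, a.2⟩, k), by simp [hk]⟩
    have h2 := Function.Bijective.comp hS h1
    convert h2 using 1
    ext x
    simp [finEquivZPowers_apply]
  constructor
  · rw [← Fintype.card_of_bijective hb]
    simp
  · rw [← Function.Bijective.prod_comp hb (fun x => x), Fintype.prod_prod_type]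
    have : ∀ a : S, ∏ y : Fin (orderOf u), (a : G) * u ^ (y : ℕ)
        = (a : G) ^ orderOf u * u ^ (∑ i ∈ Finset.range (orderOf u), i) := by
      intro a
      rw [Finset.prod_mul_distrib, Finset.prod_const, Finset.card_univ, Fintype.card_fin,
        Finset.prod_pow_eq_pow_sum, Fin.sum_univ_eq_sum_range (fun i => i)]
    simp only [this]
    rw [Finset.prod_mul_distrib, Finset.prod_const, Finset.card_univ, Fintype.card_coe,
      Finset.prod_pow, Finset.prod_coe_sort S (fun x => x)]

lemma aux_main {K : Type*} [CommRing K] [IsDomain K] [Fintype Kˣ] (u : Kˣ) (S : Finset Kˣ)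
    (d N : ℕ) (hd : 0 < d) (hord : orderOf u = d) (heven : Even (d * N))
    (hprod : ∏ x : Kˣ, x = (∏ s ∈ S, s) ^ d * (u ^ (∑ i ∈ Finset.range d, i)) ^ S.card) :
    (∏ s ∈ S, s) ^ (d * N) = (-1 : Kˣ) ^ (N * S.card) *
      ((∏ s ∈ S, s) ^ d * (u ^ (∑ i ∈ Finset.range d, i)) ^ S.card) ^ N := by
  have hw : (u ^ (∑ i ∈ Finset.range d, i)) ^ N = (-1) ^ N := by
    rcases Nat.even_or_odd' d with ⟨k, rfl | rfl⟩
    · have hs : ∑ i ∈ Finset.range (2 * k), i = k * (2 * k - 1) := by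
        rw [Finset.sum_range_id, mul_assoc, Nat.mul_div_cancel_left _ two_pos]
      have hk : 0 < k := by omega
      have hv : u ^ k = -1 := by
        have h1 : (u ^ k) ^ 2 = 1 := by
          rw [← pow_mul, mul_comm, ← hord, pow_orderOf_eq_one]
        have h2 : u ^ k ≠ 1 := fun h => by
          have := orderOf_le_of_pow_eq_one hk h
          omega
        have h3 : ((u ^ k : Kˣ) : K) ^ 2 = 1 := by rw [← Units.val_pow_eq_pow_val, h1]; rfl
        rcases mul_self_eq_one_iff.1 ((sq _).symm.trans h3) with h | h
        · exact absurd (Units.ext h) h2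
        · exact Units.ext h
      rw [hs, pow_mul, hv, Odd.neg_one_pow ⟨k - 1, by omega⟩]
    · have hs : ∑ i ∈ Finset.range (2 * k + 1), i = (2 * k + 1) * k := by
        rw [Finset.sum_range_id, Nat.add_sub_cancel, mul_left_comm, Nat.mul_div_cancel_left _ two_pos]
      have hNe : Even N := by
        rcases Nat.even_mul.1 heven with h | h
        · exact absurd h (by simp)
        · exact h
      rw [hs, pow_mul, ← hord, pow_orderOf_eq_one, one_pow, one_pow, hNe.neg_one_pow]
  rw [mul_pow, ← pow_mul, pow_right_comm _ S.card N, hw, mul_left_comm, ← pow_mul, ← pow_add,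
    ← two_mul, Even.neg_one_pow (even_two_mul _), mul_one]

/-- Let `P, Q` be distinct monic irreducible polynomials in `F_q[t]`, `η ∈ F_q^*`
of order `d`, `G = (F_q[t]/(Q))ˣ`, and `S` a complete set of coset representatives
for the subgroup generated by the image `u` of `η` in `G`. Then
`(∏_{s∈S} s)^(|P|-1) = (-1)^(((|P|-1)/d)·((|Q|-1)/d)) · (∏_{x∈G} x)^((|P|-1)/d)`. -/
theorem stmt6 {p n q d : ℕ} (hp : p.Prime) (hpodd : Odd p) (hn : 0 < n)
    (hq : q = p ^ n) (F : Type*) [Field F] [Fintype F]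
    (hcard : Fintype.card F = q) (hd : 0 < d) (hdvd : d ∣ q - 1)
    (P Q : Polynomial F) (hPm : P.Monic) (hQm : Q.Monic)
    (hPi : Irreducible P) (hQi : Irreducible Q) (hPQ : P ≠ Q)
    (η : F) (hη : orderOf η = d)
    (u : (Polynomial F ⧸ Ideal.span {Q})ˣ)
    (hu : (u : Polynomial F ⧸ Ideal.span {Q})
        = Ideal.Quotient.mk (Ideal.span {Q}) (C η))
    [Fintype (Polynomial F ⧸ Ideal.span {Q})ˣ]
    (S : Finset (Polynomial F ⧸ Ideal.span {Q})ˣ)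
    (hS : Subgroup.IsComplement (S : Set (Polynomial F ⧸ Ideal.span {Q})ˣ)
      (Subgroup.zpowers u : Set (Polynomial F ⧸ Ideal.span {Q})ˣ)) :
    (∏ s ∈ S, s) ^ (q ^ P.natDegree - 1)
      = (-1 : (Polynomial F ⧸ Ideal.span {Q})ˣ)
          ^ (((q ^ P.natDegree - 1) / d) * ((q ^ Q.natDegree - 1) / d))
        * (∏ x : (Polynomial F ⧸ Ideal.span {Q})ˣ, x)
          ^ ((q ^ P.natDegree - 1) / d) := by
  have : Fact (Irreducible Q) := ⟨hQi⟩
  have hmax : (Ideal.span {Q}).IsMaximal := PrincipalIdealRing.isMaximal_of_irreducible hQi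
  have : IsDomain (Polynomial F ⧸ Ideal.span {Q}) := Ideal.Quotient.isDomain _
  have hord : orderOf u = d := by
    rw [← orderOf_units, hu, ← hη]
    exact orderOf_injective ((Ideal.Quotient.mk (Ideal.span {Q})).comp C).toMonoidHom
      (RingHom.injective ((Ideal.Quotient.mk (Ideal.span {Q})).comp C)) η
  have hcardG : Fintype.card (Polynomial F ⧸ Ideal.span {Q})ˣ = q ^ Q.natDegree - 1 := by
    have h1 : Nat.card (AdjoinRoot Q) = q ^ Q.natDegree := by
      have := (AdjoinRoot.powerBasis hQi.ne_zero).finite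
      rw [Module.natCard_eq_pow_finrank (K := F), (AdjoinRoot.powerBasis hQi.ne_zero).finrank,
        AdjoinRoot.powerBasis_dim, Nat.card_eq_fintype_card, hcard]
    have h2 : Nat.card (AdjoinRoot Q)ˣ = Nat.card (AdjoinRoot Q) - 1 := Nat.card_units _
    rw [h1] at h2
    rw [← Nat.card_eq_fintype_card]
    exact h2
  obtain ⟨hc, hprod⟩ := aux_complement u S hS
  rw [hord] at hc hprod
  rw [hcardG] at hc
  rw [hc, Nat.mul_div_cancel _ hd, hprod]
  have hqodd : Odd q := hq ▸ hpodd.pow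
  have hdP : d ∣ q ^ P.natDegree - 1 := hdvd.trans (by simpa using Nat.sub_dvd_pow_sub_pow q 1 P.natDegree)
  have heven : Even (q ^ P.natDegree - 1) := Nat.Odd.sub_odd hqodd.pow odd_one
  obtain ⟨N, hN⟩ := hdP
  rw [hN] at heven ⊢
  rw [Nat.mul_div_cancel_left _ hd]
  exact aux_main u S d N hd hord heven hprod
end

section
/- Let P and Q be distinct monic irreducible polynomials in A = F_q[t]. Then the set of monic polynomials h with deg h < deg P + deg Q and gcd(h, PQ) = 1 is equal to the set ( {f : f monic, deg f < deg P} ∪ {hP + f : h monic, deg h < deg Q; f ∈ A, f ≠ 0, deg f < deg P} ) \ {fQ : f monic, deg f < deg P}. -/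
open Polynomial

/-- For distinct monic irreducible `P, Q` in `F_q[t]`, the set of monic
polynomials `h` with `deg h < deg P + deg Q` coprime to `PQ` equals
`({f monic : deg f < deg P} ∪ {hP + f : h monic, deg h < deg Q, f ≠ 0, deg f < deg P})
  \ {fQ : f monic, deg f < deg P}`. -/
theorem stmt8 {p n q : ℕ} (hp : p.Prime) (hpodd : Odd p) (hn : 0 < n)
    (hq : q = p ^ n) (F : Type*) [Field F] [Fintype F]
    (hcard : Fintype.card F = q)
    (P Q : Polynomial F) (hPm : P.Monic) (hQm : Q.Monic)
    (hPi : Irreducible P) (hQi : Irreducible Q) (hPQ : P ≠ Q) :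
    {h : Polynomial F | h.Monic ∧ h.natDegree < P.natDegree + Q.natDegree ∧
        IsCoprime h (P * Q)}
      = ({f : Polynomial F | f.Monic ∧ f.natDegree < P.natDegree}
          ∪ {x : Polynomial F | ∃ h f : Polynomial F, h.Monic ∧
              h.natDegree < Q.natDegree ∧ f ≠ 0 ∧ f.natDegree < P.natDegree ∧
              x = h * P + f})
        \ {x : Polynomial F | ∃ f : Polynomial F, f.Monic ∧
            f.natDegree < P.natDegree ∧ x = f * Q} := by
  have hP0 : 0 < P.natDegree := hPi.natDegree_pos
  have hQ0 : 0 < Q.natDegree := hQi.natDegree_pos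
  have key : ∀ x : Polynomial F, x.Monic → x.natDegree < P.natDegree + Q.natDegree →
      ¬ P ∣ x → (¬ ∃ f : Polynomial F, f.Monic ∧ f.natDegree < P.natDegree ∧ x = f * Q) →
      IsCoprime x (P * Q) := by
    intro x hx hd hPx hne
    refine IsCoprime.mul_right ((hPi.coprime_iff_not_dvd.2 hPx).symm)
      ((hQi.coprime_iff_not_dvd.2 ?_).symm)
    rintro ⟨g, rfl⟩
    have hg : g.Monic := hQm.of_mul_monic_left hx
    rw [hQm.natDegree_mul hg] at hd
    exact hne ⟨g, hg, by omega, mul_comm _ _⟩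
  ext x
  simp only [Set.mem_setOf_eq, Set.mem_diff, Set.mem_union]
  constructor
  · rintro ⟨hx, hd, hc⟩
    have hcP : ¬ P ∣ x := hPi.coprime_iff_not_dvd.1 hc.of_mul_right_left.symm
    have hcQ : ¬ Q ∣ x := hQi.coprime_iff_not_dvd.1 hc.of_mul_right_right.symm
    refine ⟨?_, ?_⟩
    · by_cases hlt : x.natDegree < P.natDegree
      · exact Or.inl ⟨hx, hlt⟩
      · right
        refine ⟨x /ₘ P, x %ₘ P, ?_, ?_, ?_, ?_, ?_⟩
        · have hle : P.degree ≤ x.degree := by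
            rw [degree_eq_natDegree hPm.ne_zero, degree_eq_natDegree hx.ne_zero]
            exact_mod_cast not_lt.1 hlt
          rw [Monic, leadingCoeff_divByMonic_of_monic hPm hle]
          exact hx
        · rw [natDegree_divByMonic _ hPm]; omega
        · rwa [Ne, modByMonic_eq_zero_iff_dvd hPm]
        · exact natDegree_modByMonic_lt _ hPm hPi.ne_one
        · rw [mul_comm, add_comm, modByMonic_add_div]
    · rintro ⟨f, -, -, rfl⟩
      exact hcQ (dvd_mul_left _ _)
  · rintro ⟨⟨hx, hd⟩ | ⟨h, f, hh, hhd, hf, hfd, rfl⟩, hne⟩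
    · refine ⟨hx, by omega, key x hx (by omega) ?_ hne⟩
      exact fun hdv => absurd (natDegree_le_of_dvd hdv hx.ne_zero) (by omega)
    · have hm : (h * P).Monic := hh.mul hPm
      have hnd : (h * P).natDegree = h.natDegree + P.natDegree := hh.natDegree_mul hPm
      have hlt : f.natDegree < (h * P).natDegree := by omega
      have hx : (h * P + f).Monic := hm.add_of_left (degree_lt_degree hlt)
      have hd : (h * P + f).natDegree = (h * P).natDegree :=
        natDegree_add_eq_left_of_natDegree_lt hlt
      refine ⟨hx, by omega, key _ hx (by omega) ?_ hne⟩
      intro hdv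
      have : P ∣ f := (dvd_add_right (dvd_mul_left P h)).1 hdv
      exact absurd (natDegree_le_of_dvd this hf) (by omega)
end

section
/- Let P and Q be distinct monic irreducible polynomials in A = F_q[t], let g be a generator of F_q^*, and set η = g^((q−1)/d). Let T = {h ∈ A : h monic, deg h < deg P + deg Q, gcd(h, PQ) = 1}. Then the set of residue classes {g^i · h mod PQ : 0 ≤ i < (q−1)/d, h ∈ T} is a complete set of coset representatives for the subgroup of (A/(PQ))^* generated by (the image of) η; in particular the map (i, h) ↦ g^i h mod PQ is injective on {0, …, (q−1)/d − 1} × T. -/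
open Polynomial

theorem aux_inj {F : Type*} [Field F] (M : F[X]) (a b : F) (ha : a ≠ 0)
    (h k : F[X]) (hh : h.Monic) (hk : k.Monic) (dh : h.natDegree < M.natDegree)
    (dk : k.natDegree < M.natDegree)
    (e : Ideal.Quotient.mk (Ideal.span {M}) (C a * h) = Ideal.Quotient.mk (Ideal.span {M}) (C b * k)) :
    a = b ∧ h = k := by
  rw [Ideal.Quotient.eq, Ideal.mem_span_singleton] at e
  have e0 : C a * h - C b * k = 0 := by
    apply Polynomial.eq_zero_of_dvd_of_natDegree_lt e
    refine lt_of_le_of_lt (natDegree_sub_le _ _) (max_lt ?_ ?_)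
    · exact lt_of_le_of_lt (natDegree_C_mul_le _ _) dh
    · exact lt_of_le_of_lt (natDegree_C_mul_le _ _) dk
  have e1 : C a * h = C b * k := sub_eq_zero.mp e0
  have e2 := congrArg leadingCoeff e1
  simp only [leadingCoeff_mul, leadingCoeff_C, hh.leadingCoeff, hk.leadingCoeff, mul_one] at e2
  refine ⟨e2, ?_⟩
  rw [← e2] at e1
  exact mul_left_cancel₀ (by simpa using ha) e1

theorem aux_surj {F : Type*} [Field F] (M : F[X]) (hM : M.Monic) (hM1 : 0 < M.natDegree)
    (x : (F[X] ⧸ Ideal.span {M})ˣ) :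
    ∃ a : Fˣ, ∃ h : F[X], (h.Monic ∧ h.natDegree < M.natDegree ∧ IsCoprime h M) ∧
      (x : F[X] ⧸ Ideal.span {M}) = Ideal.Quotient.mk (Ideal.span {M}) (C (a : F) * h) := by
  obtain ⟨f, hf⟩ := Ideal.Quotient.mk_surjective (x : F[X] ⧸ Ideal.span {M})
  obtain ⟨k, hk⟩ := Ideal.Quotient.mk_surjective ((x⁻¹ : (F[X] ⧸ Ideal.span {M})ˣ) : F[X] ⧸ Ideal.span {M})
  have hr : Ideal.Quotient.mk (Ideal.span {M}) (f %ₘ M) = x := by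
    rw [← hf, Ideal.Quotient.eq, Ideal.mem_span_singleton]
    exact ⟨-(f /ₘ M), by linear_combination modByMonic_add_div f M⟩
  set r := f %ₘ M with hrdef
  have hdeg : r.natDegree < M.natDegree := natDegree_modByMonic_lt f hM (by rintro rfl; simp at hM1)
  have hcop : IsCoprime r M := by
    have : Ideal.Quotient.mk (Ideal.span {M}) (r * k) = Ideal.Quotient.mk (Ideal.span {M}) 1 := by
      rw [map_mul, hr, hk, map_one, Units.mul_inv]
    rw [Ideal.Quotient.eq, Ideal.mem_span_singleton] at this
    obtain ⟨c, hc⟩ := this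
    exact ⟨k, -c, by linear_combination hc⟩
  have hr0 : r ≠ 0 := by
    intro h0
    rw [h0, isCoprime_zero_left] at hcop
    have := natDegree_eq_zero_of_isUnit hcop
    omega
  have hl : r.leadingCoeff ≠ 0 := by simpa using hr0
  refine ⟨Units.mk0 r.leadingCoeff hl, C r.leadingCoeff⁻¹ * r, ⟨?_, ?_, ?_⟩, ?_⟩
  · rw [mul_comm]; exact monic_mul_leadingCoeff_inv hr0
  · exact lt_of_le_of_lt (natDegree_C_mul_le _ _) hdeg
  · exact (isCoprime_mul_unit_left_left (by simpa using hl) r M).mpr hcop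
  · rw [← hr, Units.val_mk0, ← mul_assoc, ← C_mul, mul_inv_cancel₀ hl, C_1, one_mul]

/-- Let `P, Q` be distinct monic irreducibles in `F_q[t]`, `g` a generator of
`F_q^*`, `η = g^((q-1)/d)` with image `u` in `(F_q[t]/(PQ))ˣ`, and
`T = {h monic : deg h < deg P + deg Q, gcd(h, PQ) = 1}`. Then the classes
`g^i · h mod PQ` for `0 ≤ i < (q-1)/d`, `h ∈ T` form a complete set of coset
representatives for `⟨u⟩`, and `(i, h) ↦ g^i h mod PQ` is injective on
`{0, …, (q-1)/d - 1} × T`. -/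
theorem stmt9 {p n q d : ℕ} (hp : p.Prime) (hpodd : Odd p) (hn : 0 < n)
    (hq : q = p ^ n) (F : Type*) [Field F] [Fintype F]
    (hcard : Fintype.card F = q) (hd : 0 < d) (hdvd : d ∣ q - 1)
    (P Q : Polynomial F) (hPm : P.Monic) (hQm : Q.Monic)
    (hPi : Irreducible P) (hQi : Irreducible Q) (hPQ : P ≠ Q)
    (g : Fˣ) (hg : ∀ x : Fˣ, x ∈ Subgroup.zpowers g)
    (u : (Polynomial F ⧸ Ideal.span {P * Q})ˣ)
    (hu : (u : Polynomial F ⧸ Ideal.span {P * Q})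
        = Ideal.Quotient.mk (Ideal.span {P * Q}) (C ((g : F) ^ ((q - 1) / d)))) :
    Subgroup.IsComplement
      ({x : (Polynomial F ⧸ Ideal.span {P * Q})ˣ |
          ∃ i < (q - 1) / d, ∃ h : Polynomial F,
            (h.Monic ∧ h.natDegree < P.natDegree + Q.natDegree ∧
              IsCoprime h (P * Q)) ∧
            (x : Polynomial F ⧸ Ideal.span {P * Q})
              = Ideal.Quotient.mk (Ideal.span {P * Q}) (C ((g : F) ^ i) * h)})
      (Subgroup.zpowers u : Set (Polynomial F ⧸ Ideal.span {P * Q})ˣ) ∧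
    Set.InjOn
      (fun pr : ℕ × Polynomial F =>
        Ideal.Quotient.mk (Ideal.span {P * Q}) (C ((g : F) ^ pr.1) * pr.2))
      ({i : ℕ | i < (q - 1) / d} ×ˢ
        {h : Polynomial F | h.Monic ∧ h.natDegree < P.natDegree + Q.natDegree ∧
          IsCoprime h (P * Q)}) := by
  classical
  have hMm : (P * Q).Monic := hPm.mul hQm
  have hdM : (P * Q).natDegree = P.natDegree + Q.natDegree := hPm.natDegree_mul hQm
  have hM1 : 0 < (P * Q).natDegree := by
    rw [hdM]; have := hPi.natDegree_pos; omega
  rw [← hdM]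
  generalize P * Q = M at *
  have hord : orderOf g = q - 1 := by
    rw [orderOf_eq_card_of_forall_mem_zpowers hg, Nat.card_eq_fintype_card, Fintype.card_units, hcard]
  have hq1 : 0 < q - 1 := by rw [← hord]; exact orderOf_pos g
  obtain ⟨m, hm⟩ : ∃ m, m = (q - 1) / d := ⟨_, rfl⟩
  rw [← hm] at hu ⊢
  have hmd : m ∣ q - 1 := hm ▸ Nat.div_dvd_of_dvd hdvd
  have hm0 : 0 < m := Nat.pos_of_dvd_of_pos hmd hq1
  have key : ∀ z w : ℤ, g ^ z = g ^ w → (m : ℤ) ∣ z - w := by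
    intro z w e
    have : ((q - 1 : ℕ) : ℤ) ∣ z - w := by
      rw [← hord, orderOf_dvd_iff_zpow_eq_one, zpow_sub, e, mul_inv_cancel]
    exact (Int.natCast_dvd_natCast.mpr hmd).trans this
  have keyi : ∀ i j : ℕ, i < m → j < m → (m : ℤ) ∣ (i : ℤ) - j → i = j := by
    intro i j hi hj e
    have := Int.eq_zero_of_abs_lt_dvd e (by rw [abs_lt]; omega)
    omega
  let φ : Fˣ →* (F[X] ⧸ Ideal.span {M})ˣ :=
    Units.map ((Ideal.Quotient.mk (Ideal.span {M})).comp C : F →+* _)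
  have hφ : ∀ a : Fˣ, (φ a : F[X] ⧸ Ideal.span {M}) = Ideal.Quotient.mk (Ideal.span {M}) (C (a : F)) :=
    fun a => rfl
  have huφ : u = φ (g ^ m) := by
    ext; rw [hu, hφ]; simp
  have huk : ∀ k : ℤ, u ^ k = φ (g ^ (m * k)) := by
    intro k; rw [huφ, ← map_zpow, zpow_mul, zpow_natCast]
  refine ⟨⟨?_, ?_⟩, ?_⟩
  · rintro ⟨⟨x, i, hi, h, ⟨hh1, hh2, hh3⟩, hx⟩, ⟨y, k, rfl⟩⟩ ⟨⟨x', i', hi', h', ⟨hh1', hh2', hh3'⟩, hx'⟩, ⟨y', k', rfl⟩⟩ e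
    simp only [huk] at e
    have e1 := congrArg (Units.val) e
    have conv : ∀ (i : ℕ) (k : ℤ) (h : F[X]),
        Ideal.Quotient.mk (Ideal.span {M}) (C ((g : F) ^ i) * h) * (φ (g ^ (m * k)) : F[X] ⧸ Ideal.span {M})
          = Ideal.Quotient.mk (Ideal.span {M}) (C ((g ^ ((i : ℤ) + m * k) : Fˣ) : F) * h) := by
      intro i k h
      rw [hφ, ← map_mul, zpow_add, Units.val_mul, C_mul, zpow_natCast, Units.val_pow_eq_pow_val]
      congr 1; ring
    rw [Units.val_mul, Units.val_mul, hx, hx', conv, conv] at e1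
    obtain ⟨ea, eh⟩ := aux_inj M _ _ (Units.ne_zero _) h h' hh1 hh1' hh2 hh2' e1
    have d1 := key _ _ (Units.ext ea)
    have d2 : (m : ℤ) ∣ (i : ℤ) - i' := by
      have : (i : ℤ) - i' = (i + m * k - (i' + m * k')) - m * (k - k') := by ring
      rw [this]; exact dvd_sub d1 (dvd_mul_right _ _)
    have ei := keyi i i' hi hi' d2
    have ex : x = x' := by ext; rw [hx, hx', ei, eh]
    subst ex
    have ek := mul_left_cancel e
    simp only [Prod.mk.injEq, Subtype.mk.injEq, true_and, huk]
    exact ek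
  · intro x
    obtain ⟨a, h, hh, hx⟩ := aux_surj M hMm hM1 x
    obtain ⟨z, rfl⟩ := hg a
    have hmz : (m : ℤ) ≠ 0 := by omega
    have h0 := Int.emod_nonneg z hmz
    have h1 := Int.emod_lt_of_pos z (show (0 : ℤ) < m by omega)
    obtain ⟨i, hi⟩ := Int.eq_ofNat_of_zero_le h0
    have hz : z = i + m * (z / m) := by rw [← hi]; exact (Int.emod_add_mul_ediv z m).symm
    refine ⟨⟨⟨x * (u ^ (z / m))⁻¹, i, by omega, h, hh, ?_⟩, ⟨u ^ (z / m), z / m, rfl⟩⟩, ?_⟩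
    · have hc : (g ^ z * (g ^ (m * (z / m)))⁻¹ : Fˣ) = g ^ i := by
        rw [← zpow_neg, ← zpow_add, ← zpow_natCast]; congr 1; linarith
      rw [huk, ← map_inv, Units.val_mul, hx, hφ, ← map_mul, ← Units.val_pow_eq_pow_val, ← hc,
        Units.val_mul, C_mul]
      congr 1; simp only []; ring
    · simp
  · rintro ⟨i, h⟩ ⟨hi, hh1, hh2, hh3⟩ ⟨j, k⟩ ⟨hj, hk1, hk2, hk3⟩ e
    simp only [Set.mem_ofPred_eq] at hi hj
    obtain ⟨ea, eh⟩ := aux_inj M _ _ (pow_ne_zero _ (Units.ne_zero _)) h k hh1 hk1 hh2 hk2 e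
    have : g ^ (i : ℤ) = g ^ (j : ℤ) := by ext; simpa using ea
    exact Prod.ext (keyi i j hi hj (key _ _ this)) eh
end

section
/- Let P and Q be distinct monic irreducible polynomials in A = F_q[t] and let η ∈ F_q^* have order d. Let S_P = {f ∈ A : f ≠ 0, deg f < deg P}, and let S ⊆ (A/(Q))^* be a complete set of coset representatives for the subgroup generated by (the image of) η in (A/(Q))^*. Then the set {(f mod P, s) : f ∈ S_P, s ∈ S} is a complete set of coset representatives for the cyclic subgroup U generated by (η, η) in the product group (A/(P))^* × (A/(Q))^*. -/
open Polynomial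

theorem aux_order {F : Type*} [Field F] (P : Polynomial F) (hPi : Irreducible P) (η : F)
    (u : (Polynomial F ⧸ Ideal.span {P})ˣ)
    (hu : (u : Polynomial F ⧸ Ideal.span {P}) = Ideal.Quotient.mk (Ideal.span {P}) (C η)) :
    orderOf u = orderOf η := by
  have hne : Nontrivial (Polynomial F ⧸ Ideal.span {P}) := by
    apply Ideal.Quotient.nontrivial_iff.mpr
    rw [Ne, Ideal.span_singleton_eq_top]
    exact hPi.not_isUnit
  rw [← orderOf_units, hu]
  exact orderOf_injective ((Ideal.Quotient.mk (Ideal.span {P})).comp C).toMonoidHom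
    ((Ideal.Quotient.mk (Ideal.span {P})).comp C).injective η

theorem aux_rep {F : Type*} [Field F] (P : Polynomial F) (hPm : P.Monic) (hPi : Irreducible P)
    (u : (Polynomial F ⧸ Ideal.span {P})ˣ) :
    ∃ f : Polynomial F, f ≠ 0 ∧ f.natDegree < P.natDegree ∧
      (u : Polynomial F ⧸ Ideal.span {P}) = Ideal.Quotient.mk (Ideal.span {P}) f := by
  have hne : Nontrivial (Polynomial F ⧸ Ideal.span {P}) := by
    apply Ideal.Quotient.nontrivial_iff.mpr
    rw [Ne, Ideal.span_singleton_eq_top]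
    exact hPi.not_isUnit
  obtain ⟨g, hg⟩ := Ideal.Quotient.mk_surjective (u : Polynomial F ⧸ Ideal.span {P})
  have h : (u : Polynomial F ⧸ Ideal.span {P}) =
      Ideal.Quotient.mk (Ideal.span {P}) (g %ₘ P) := by
    rw [← hg, Ideal.Quotient.eq, Ideal.mem_span_singleton]
    exact ⟨g /ₘ P, by linear_combination - modByMonic_add_div g P⟩
  refine ⟨g %ₘ P, ?_, natDegree_modByMonic_lt g hPm hPi.ne_one, h⟩
  intro h0
  rw [h0, map_zero] at h
  exact u.ne_zero h

/-- Let `P, Q` be distinct monic irreducibles in `F_q[t]` and `η ∈ F_q^*` of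
order `d`, with images `uP ∈ (F_q[t]/(P))ˣ` and `uQ ∈ (F_q[t]/(Q))ˣ`. Let
`S_P = {f : f ≠ 0, deg f < deg P}` and let `S` be a complete set of coset
representatives for `⟨uQ⟩` in `(F_q[t]/(Q))ˣ`. Then
`{(f mod P, s) : f ∈ S_P, s ∈ S}` is a complete set of coset representatives
for the cyclic subgroup generated by `(uP, uQ)` in
`(F_q[t]/(P))ˣ × (F_q[t]/(Q))ˣ`. -/
theorem stmt10 {p n q d : ℕ} (hp : p.Prime) (hpodd : Odd p) (hn : 0 < n)
    (hq : q = p ^ n) (F : Type*) [Field F] [Fintype F]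
    (hcard : Fintype.card F = q) (hd : 0 < d) (hdvd : d ∣ q - 1)
    (P Q : Polynomial F) (hPm : P.Monic) (hQm : Q.Monic)
    (hPi : Irreducible P) (hQi : Irreducible Q) (hPQ : P ≠ Q)
    (η : F) (hη : orderOf η = d)
    (uP : (Polynomial F ⧸ Ideal.span {P})ˣ)
    (huP : (uP : Polynomial F ⧸ Ideal.span {P})
        = Ideal.Quotient.mk (Ideal.span {P}) (C η))
    (uQ : (Polynomial F ⧸ Ideal.span {Q})ˣ)
    (huQ : (uQ : Polynomial F ⧸ Ideal.span {Q})
        = Ideal.Quotient.mk (Ideal.span {Q}) (C η))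
    (S : Set (Polynomial F ⧸ Ideal.span {Q})ˣ)
    (hS : Subgroup.IsComplement S
      (Subgroup.zpowers uQ : Set (Polynomial F ⧸ Ideal.span {Q})ˣ)) :
    Subgroup.IsComplement
      ({x : (Polynomial F ⧸ Ideal.span {P})ˣ × (Polynomial F ⧸ Ideal.span {Q})ˣ |
          ∃ f : Polynomial F, f ≠ 0 ∧ f.natDegree < P.natDegree ∧
            (x.1 : Polynomial F ⧸ Ideal.span {P})
              = Ideal.Quotient.mk (Ideal.span {P}) f ∧ x.2 ∈ S})
      (Subgroup.zpowers (uP, uQ) :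
        Set ((Polynomial F ⧸ Ideal.span {P})ˣ × (Polynomial F ⧸ Ideal.span {Q})ˣ)) := by
  have hP := aux_order P hPi η uP huP
  have hQ := aux_order Q hQi η uQ huQ
  have key : ∀ j k : ℤ, uQ ^ j = uQ ^ k → uP ^ j = uP ^ k := by
    intro j k h
    rw [zpow_eq_zpow_iff_modEq] at h ⊢
    rwa [hP, ← hQ]
  constructor
  · rintro ⟨⟨⟨a, b⟩, f, -, -, -, hb⟩, ⟨_, j, rfl⟩⟩ ⟨⟨⟨a', b'⟩, f', -, -, -, hb'⟩, ⟨_, k, rfl⟩⟩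
    intro h
    have h1 := congrArg Prod.fst h
    have h2 := congrArg Prod.snd h
    change a * uP ^ j = a' * uP ^ k at h1
    change b * uQ ^ j = b' * uQ ^ k at h2
    have h3 := @hS.1 (⟨b, hb⟩, ⟨uQ ^ j, j, rfl⟩) (⟨b', hb'⟩, ⟨uQ ^ k, k, rfl⟩) h2
    simp only [Prod.mk.injEq, Subtype.mk.injEq] at h3
    obtain ⟨h4, h5⟩ := h3
    replace h5 : uQ ^ j = uQ ^ k := congrArg Subtype.val h5
    have h6 := key j k h5
    rw [h6] at h1
    have h7 := mul_right_cancel h1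
    subst h4 h7
    simp [h5, h6]
  · rintro ⟨a, b⟩
    obtain ⟨⟨⟨s, hs⟩, ⟨_, k, rfl⟩⟩, h⟩ := hS.2 b
    obtain ⟨f, h1, h2, h3⟩ := aux_rep P hPm hPi (a * (uP ^ k)⁻¹)
    refine ⟨(⟨(a * (uP ^ k)⁻¹, s), f, h1, h2, h3, hs⟩, ⟨(uP, uQ) ^ k, k, rfl⟩), ?_⟩
    refine Prod.ext ?_ h
    change a * (uP ^ k)⁻¹ * uP ^ k = a
    group
end

section
/- Let P and Q be distinct monic irreducible polynomials in A = F_q[t], let g be a generator of F_q^*, and let T = {h ∈ A : h monic, deg h < deg P + deg Q, gcd(h, PQ) = 1}. Suppose α ∈ F_q satisfies Q^((|P|−1)/d) ≡ α (mod P) (i.e., α = (Q/P)_d). Then the following congruence holds modulo P: α · ∏_{i=0}^{(q−1)/d − 1} ∏_{h ∈ T} (g^i · h) ≡ ( ∏_{f ∈ A, f ≠ 0, deg f < deg P} f )^((|Q|−1)/d) (mod P). -/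
open Polynomial

theorem aux_exists {F : Type*} [Field F] [Fintype F] (n : ℕ) :
    ∃ L : Finset (Polynomial F), (∀ f, f ∈ L ↔ f.degree < n) ∧ L.card = Fintype.card F ^ n := by
  classical
  let e := Polynomial.degreeLTEquiv F n
  haveI : Fintype (Polynomial.degreeLT F n) := Fintype.ofEquiv _ e.toEquiv.symm
  refine ⟨Finset.univ.map (Function.Embedding.subtype (· ∈ Polynomial.degreeLT F n)), ?_, ?_⟩
  · intro f
    simp [Polynomial.mem_degreeLT]
  · rw [Finset.card_map, Finset.card_univ, Fintype.card_congr e.toEquiv]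
    simp

theorem aux_monic {F : Type*} [Field F] [Fintype F] (n : ℕ) (hn : 0 < n) :
    ∃ M : Finset (Polynomial F), (∀ f, f ∈ M ↔ f.Monic ∧ f.natDegree < n) ∧
      M.card * (Fintype.card F - 1) = Fintype.card F ^ n - 1 := by
  classical
  obtain ⟨L, hL, hc⟩ := aux_exists (F := F) n
  have hdeg : ∀ f : Polynomial F, f ≠ 0 → (f.degree < n ↔ f.natDegree < n) :=
    fun f hf => (Polynomial.natDegree_lt_iff_degree_lt hf).symm
  have hM : ∀ f, f ∈ L.filter (fun f => f.Monic) ↔ f.Monic ∧ f.natDegree < n := by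
    intro f
    rw [Finset.mem_filter, hL, and_comm]
    exact and_congr_right fun h => hdeg f h.ne_zero
  refine ⟨_, hM, ?_⟩
  have h0 : (0 : Polynomial F) ∈ L := by
    rw [hL]; simp
  rw [← hc, ← Finset.card_erase_of_mem h0, ← Fintype.card_units, ← Finset.card_univ,
    ← Finset.card_product]
  refine Finset.card_bij (fun x _ => C (x.2 : F) * x.1) ?_ ?_ ?_
  · rintro ⟨f, u⟩ h
    simp only [Finset.mem_product, hM, Finset.mem_univ, and_true] at h
    have hne : C (u : F) * f ≠ 0 := mul_ne_zero (by simp) h.1.ne_zero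
    rw [Finset.mem_erase, hL]
    refine ⟨hne, ?_⟩
    rw [hdeg _ hne, natDegree_C_mul u.ne_zero]
    exact h.2
  · rintro ⟨f, u⟩ h ⟨f', u'⟩ h' he
    simp only [Finset.mem_product, hM, Finset.mem_univ, and_true] at h h' he
    have := congrArg leadingCoeff he
    simp only [leadingCoeff_mul, leadingCoeff_C, h.1.leadingCoeff, h'.1.leadingCoeff, mul_one] at this
    have hu : u = u' := Units.ext this
    subst hu
    have := mul_left_cancel₀ (by simp : C (u : F) ≠ 0) he
    rw [this]
  · intro f hf
    rw [Finset.mem_erase, hL] at hf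
    have hl : f.leadingCoeff ≠ 0 := leadingCoeff_ne_zero.mpr hf.1
    refine ⟨(C f.leadingCoeff⁻¹ * f, Units.mk0 _ hl), ?_, ?_⟩
    · simp only [Finset.mem_product, hM, Finset.mem_univ, and_true]
      refine ⟨?_, ?_⟩
      · rw [Monic, leadingCoeff_mul, leadingCoeff_C, inv_mul_cancel₀ hl]
      · rw [natDegree_C_mul (inv_ne_zero hl)]
        exact (hdeg _ hf.1).1 hf.2
    · simp only [Units.val_mk0]
      rw [← mul_assoc, ← C_mul, mul_inv_cancel₀ hl, C_1, one_mul]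

theorem aux_prod {F : Type*} [Field F] [Fintype F]
    (P Q : Polynomial F) (hPm : P.Monic) (hQm : Q.Monic)
    (hPi : Irreducible P) (hQi : Irreducible Q) (hPQ : P ≠ Q)
    (T SP MP MQ : Finset (Polynomial F))
    (hT : ∀ h : Polynomial F, h ∈ T ↔
      h.Monic ∧ h.natDegree < P.natDegree + Q.natDegree ∧ IsCoprime h (P * Q))
    (hSP : ∀ f : Polynomial F, f ∈ SP ↔ f ≠ 0 ∧ f.natDegree < P.natDegree)
    (hMP : ∀ f : Polynomial F, f ∈ MP ↔ f.Monic ∧ f.natDegree < P.natDegree)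
    (hMQ : ∀ f : Polynomial F, f ∈ MQ ↔ f.Monic ∧ f.natDegree < Q.natDegree)
    {M : Type*} [CommMonoid M] (φ : Polynomial F → M)
    (hφ : ∀ a r, φ (a * P + r) = φ r) :
    (∏ h ∈ T, φ h) * ∏ k ∈ MP, φ (Q * k) = (∏ k ∈ MP, φ k) * (∏ f ∈ SP, φ f) ^ MQ.card := by
  classical
  have hPnQ : ¬ P ∣ Q := fun h =>
    hPQ (eq_of_monic_of_associated hPm hQm (hPi.associated_of_dvd hQi h))
  have hsmall : ∀ f : Polynomial F, f ≠ 0 → f.natDegree < P.natDegree → ¬ P ∣ f :=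
    fun f h0 hd h => absurd (natDegree_le_of_dvd h h0) (not_le.mpr hd)
  have hcop : ∀ h : Polynomial F, IsCoprime h (P * Q) ↔ ¬ P ∣ h ∧ ¬ Q ∣ h := by
    intro h
    rw [IsCoprime.mul_right_iff, isCoprime_comm, hPi.coprime_iff_not_dvd,
      isCoprime_comm (x := h), hQi.coprime_iff_not_dvd]
  have hinj : Set.InjOn (fun k => Q * k) (MP : Set (Polynomial F)) :=
    fun a _ b _ h => mul_left_cancel₀ hQi.ne_zero h
  have hinj2 : Set.InjOn (fun x : Polynomial F × Polynomial F => x.1 * P + x.2)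
      (MQ ×ˢ SP : Finset (Polynomial F × Polynomial F)) := by
    rintro ⟨a, r⟩ h ⟨a', r'⟩ h' he
    simp only [Finset.coe_product, Set.mem_prod, Finset.mem_coe, hMQ, hSP] at h h' he
    have key : ∀ a r : Polynomial F, r ≠ 0 → r.natDegree < P.natDegree →
        (a * P + r) /ₘ P = a ∧ (a * P + r) %ₘ P = r := by
      intro a r h0 hd
      exact div_modByMonic_unique a r hPm ⟨by ring, (natDegree_lt_natDegree_iff h0).1 hd⟩
    have k1 := key a r h.2.1 h.2.2
    have k2 := key a' r' h'.2.1 h'.2.2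
    rw [he] at k1
    rw [Prod.mk.injEq]
    exact ⟨k1.1.symm.trans k2.1, k1.2.symm.trans k2.2⟩
  have hU1 : ∀ h, h ∈ T ∪ MP.image (fun k => Q * k) ↔
      h.Monic ∧ h.natDegree < P.natDegree + Q.natDegree ∧ ¬ P ∣ h := by
    intro h
    rw [Finset.mem_union, hT, hcop, Finset.mem_image]
    constructor
    · rintro (⟨h1, h2, h3, h4⟩ | ⟨k, hk, rfl⟩)
      · exact ⟨h1, h2, h3⟩
      · rw [hMP] at hk
        refine ⟨hQm.mul hk.1, ?_, ?_⟩
        · rw [hQm.natDegree_mul hk.1]; omega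
        · intro hd
          rcases hPi.prime.dvd_or_dvd hd with hd | hd
          · exact hPnQ hd
          · exact hsmall k hk.1.ne_zero hk.2 hd
    · rintro ⟨h1, h2, h3⟩
      by_cases hQ : Q ∣ h
      · right
        obtain ⟨k, rfl⟩ := hQ
        have hk : k.Monic := hQm.of_mul_monic_left h1
        rw [hQm.natDegree_mul hk] at h2
        exact ⟨k, (hMP k).2 ⟨hk, by omega⟩, rfl⟩
      · exact Or.inl ⟨h1, h2, h3, hQ⟩
  have hd1 : Disjoint T (MP.image (fun k => Q * k)) := by
    rw [Finset.disjoint_left]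
    intro h hh hk
    rw [hT, hcop] at hh
    obtain ⟨k, -, rfl⟩ := Finset.mem_image.1 hk
    exact hh.2.2.2 (dvd_mul_right _ _)
  have hdegsum : ∀ a r : Polynomial F, a.Monic → r ≠ 0 → r.natDegree < P.natDegree →
      (a * P + r).Monic ∧ (a * P + r).natDegree = a.natDegree + P.natDegree := by
    intro a r ha h0 hd
    have hn := ha.natDegree_mul hPm
    have hlt : r.degree < (a * P).degree := by
      rw [← natDegree_lt_natDegree_iff h0]; omega
    exact ⟨(ha.mul hPm).add_of_left hlt, by
      rw [natDegree_add_eq_left_of_degree_lt hlt, hn]⟩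
  have hU2 : ∀ h, h ∈ MP ∪ (MQ ×ˢ SP).image (fun x => x.1 * P + x.2) ↔
      h.Monic ∧ h.natDegree < P.natDegree + Q.natDegree ∧ ¬ P ∣ h := by
    intro h
    rw [Finset.mem_union, hMP, Finset.mem_image]
    constructor
    · rintro (⟨h1, h2⟩ | ⟨⟨a, r⟩, hk, rfl⟩)
      · exact ⟨h1, by omega, hsmall h h1.ne_zero h2⟩
      · simp only [Finset.mem_product, hMQ, hSP] at hk ⊢
        obtain ⟨⟨h1, h2⟩, h3, h4⟩ := hk
        have := hdegsum a r h1 h3 h4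
        refine ⟨this.1, by omega, ?_⟩
        intro hd
        exact hsmall r h3 h4 ((dvd_add_right (dvd_mul_left P a)).1 hd)
    · rintro ⟨h1, h2, h3⟩
      by_cases hlt : h.natDegree < P.natDegree
      · exact Or.inl ⟨h1, hlt⟩
      · right
        have hle : P.degree ≤ h.degree := by
          rw [degree_eq_natDegree hPm.ne_zero, degree_eq_natDegree h1.ne_zero]
          exact_mod_cast not_lt.mp hlt
        refine ⟨(h /ₘ P, h %ₘ P), ?_, ?_⟩
        · simp only [Finset.mem_product, hMQ, hSP]
          have hr0 : h %ₘ P ≠ 0 := fun e => h3 ((modByMonic_eq_zero_iff_dvd hPm).1 e)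
          refine ⟨⟨?_, ?_⟩, hr0, ?_⟩
          · rw [Monic, leadingCoeff_divByMonic_of_monic hPm hle]; exact h1
          · rw [natDegree_divByMonic h hPm]
            omega
          · exact (natDegree_lt_natDegree_iff hr0).2 (degree_modByMonic_lt h hPm)
        · have := modByMonic_add_div h P
          simp only
          rw [mul_comm, add_comm]; exact this
  have hd2 : Disjoint MP ((MQ ×ˢ SP).image (fun x => x.1 * P + x.2)) := by
    rw [Finset.disjoint_left]
    intro h hh hk
    rw [hMP] at hh
    obtain ⟨⟨a, r⟩, hk', rfl⟩ := Finset.mem_image.1 hk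
    simp only [Finset.mem_product, hMQ, hSP] at hk' hh
    have := hdegsum a r hk'.1.1 hk'.2.1 hk'.2.2
    omega
  have hU : T ∪ MP.image (fun k => Q * k) = MP ∪ (MQ ×ˢ SP).image (fun x => x.1 * P + x.2) := by
    ext h
    rw [hU1, hU2]
  have := congrArg (fun s => ∏ h ∈ s, φ h) hU
  simp only [Finset.prod_union hd1, Finset.prod_union hd2, Finset.prod_image hinj,
    Finset.prod_image hinj2] at this
  rw [this, Finset.prod_product]
  simp only [hφ, Finset.prod_const]

/-- Let `P, Q` be distinct monic irreducibles in `F_q[t]`, `g` a generator of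
`F_q^*`, `T = {h monic : deg h < deg P + deg Q, gcd(h, PQ) = 1}`, and suppose
`α ∈ F_q` satisfies `Q^((|P|-1)/d) ≡ α (mod P)`. Then
`α · ∏_{i=0}^{(q-1)/d - 1} ∏_{h∈T} g^i h ≡ (∏_{f ≠ 0, deg f < deg P} f)^((|Q|-1)/d) (mod P)`. -/
theorem stmt11 {p n q d : ℕ} (hp : p.Prime) (hpodd : Odd p) (hn : 0 < n)
    (hq : q = p ^ n) (F : Type*) [Field F] [Fintype F]
    (hcard : Fintype.card F = q) (hd : 0 < d) (hdvd : d ∣ q - 1)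
    (P Q : Polynomial F) (hPm : P.Monic) (hQm : Q.Monic)
    (hPi : Irreducible P) (hQi : Irreducible Q) (hPQ : P ≠ Q)
    (g : Fˣ) (hg : ∀ x : Fˣ, x ∈ Subgroup.zpowers g)
    (α : F) (hα : P ∣ Q ^ ((q ^ P.natDegree - 1) / d) - C α)
    (T SP : Finset (Polynomial F))
    (hT : ∀ h : Polynomial F, h ∈ T ↔
      h.Monic ∧ h.natDegree < P.natDegree + Q.natDegree ∧ IsCoprime h (P * Q))
    (hSP : ∀ f : Polynomial F, f ∈ SP ↔ f ≠ 0 ∧ f.natDegree < P.natDegree) :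
    P ∣ C α * (∏ i ∈ Finset.range ((q - 1) / d), ∏ h ∈ T, (C ((g : F) ^ i) * h))
        - (∏ f ∈ SP, f) ^ ((q ^ Q.natDegree - 1) / d) := by
  classical
  have hP0 := hPi.natDegree_pos
  have hQ0 := hQi.natDegree_pos
  obtain ⟨MP, hMP, cP⟩ := aux_monic (F := F) P.natDegree hP0
  obtain ⟨MQ, hMQ, cQ⟩ := aux_monic (F := F) Q.natDegree hQ0
  rw [hcard] at cP cQ
  obtain ⟨N, hN⟩ := hdvd
  have eN : (q - 1) / d = N := by rw [hN, Nat.mul_div_cancel_left _ hd]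
  have eP : (q ^ P.natDegree - 1) / d = MP.card * N := by
    rw [← cP, hN, mul_left_comm, Nat.mul_div_cancel_left _ hd]
  have eQ : (q ^ Q.natDegree - 1) / d = MQ.card * N := by
    rw [← cQ, hN, mul_left_comm, Nat.mul_div_cancel_left _ hd]
  rw [eP] at hα
  rw [eN, eQ]
  haveI : Fact (Irreducible P) := ⟨hPi⟩
  rw [← AdjoinRoot.mk_eq_zero, map_sub, sub_eq_zero] at hα ⊢
  have key : ∀ i : ℕ, (∏ h ∈ T, AdjoinRoot.mk P (C ((g : F) ^ i) * h)) *
      AdjoinRoot.mk P Q ^ MP.card = (AdjoinRoot.mk P (∏ f ∈ SP, f)) ^ MQ.card := by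
    intro i
    have hc : ((g : F) ^ i) ≠ 0 := pow_ne_zero _ g.ne_zero
    have h := aux_prod P Q hPm hQm hPi hQi hPQ T SP MP MQ hT hSP hMP hMQ
      (fun h => AdjoinRoot.mk P (C ((g : F) ^ i) * h)) (by
        intro a r
        have : C ((g : F) ^ i) * (a * P + r) = P * (C ((g : F) ^ i) * a) + C ((g : F) ^ i) * r := by
          ring
        rw [this, map_add, map_mul, AdjoinRoot.mk_self, zero_mul, zero_add])
    have hs : ∏ f ∈ SP, AdjoinRoot.mk P (C ((g : F) ^ i) * f) = AdjoinRoot.mk P (∏ f ∈ SP, f) := by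
      rw [map_prod]
      refine Finset.prod_bij (fun f _ => C ((g : F) ^ i) * f) ?_ ?_ ?_ ?_
      · intro f hf
        rw [hSP] at hf ⊢
        rw [natDegree_C_mul hc]
        exact ⟨mul_ne_zero (C_ne_zero.2 hc) hf.1, hf.2⟩
      · intro a _ b _ h
        exact mul_left_cancel₀ (C_ne_zero.2 hc) h
      · intro f hf
        rw [hSP] at hf
        refine ⟨C ((g : F) ^ i)⁻¹ * f, ?_, ?_⟩
        · rw [hSP, natDegree_C_mul (inv_ne_zero hc)]
          exact ⟨mul_ne_zero (C_ne_zero.2 (inv_ne_zero hc)) hf.1, hf.2⟩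
        · rw [← mul_assoc, ← C_mul, mul_inv_cancel₀ hc, C_1, one_mul]
      · intro f _
        rfl
    have hq1 : ∏ k ∈ MP, AdjoinRoot.mk P (C ((g : F) ^ i) * (Q * k)) =
        AdjoinRoot.mk P Q ^ MP.card * ∏ k ∈ MP, AdjoinRoot.mk P (C ((g : F) ^ i) * k) := by
      rw [← Finset.prod_const, ← Finset.prod_mul_distrib]
      refine Finset.prod_congr rfl fun k _ => ?_
      rw [← map_mul]
      congr 1
      ring
    have hne : ∏ k ∈ MP, AdjoinRoot.mk P (C ((g : F) ^ i) * k) ≠ 0 := by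
      refine Finset.prod_ne_zero_iff.2 fun k hk h0 => ?_
      rw [hMP] at hk
      rw [AdjoinRoot.mk_eq_zero] at h0
      have := natDegree_le_of_dvd h0 (mul_ne_zero (C_ne_zero.2 hc) hk.1.ne_zero)
      rw [natDegree_C_mul hc] at this
      omega
    simp only [hs, hq1] at h
    apply mul_left_cancel₀ hne
    rw [← h]
    ring
  have h := Finset.prod_congr (rfl : Finset.range N = Finset.range N) (fun i _ => key i)
  rw [Finset.prod_mul_distrib, Finset.prod_const, Finset.prod_const, Finset.card_range,
    ← pow_mul, ← pow_mul, ← map_pow, hα] at h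
  rw [map_mul, map_pow, ← h, mul_comm]
  simp only [map_prod]
end
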